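/- Let X be a metric space and G a nonempty, proper subset of X with nonempty boundary ∂G such that d_G(x) = inf{dist(x,z) : z ∈ ∂G} ≤ 1 for all x ∈ G. For a constant 0 < c ≤ √2, the function υ(x,y) = dist(x,y) / (dist(x,y) + c·√((1 + d_G(x))(1 + d_G(y)))) is a metric on G: υ(x,y) ≥ 0 with υ(x,y) = 0 iff x = y, υ(x,y) = υ(y,x), and υ(x,y) ≤ υ(x,z) + υ(z,y) for all x, y, z ∈ G. -/

import Mathlib

theorem mul_sq_sub_mul_le {c q r v : ℝ} (hc0 : 0 ≤ c) (hc : c ≤ 3 / 2) (hq : 1 ≤ q)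
    (hr : 0 ≤ r) (hr2 : r ^ 2 ≤ 2) (hv0 : 0 ≤ v) (hv : r ^ 2 - q ^ 2 ≤ v) :
    c * (r ^ 2 - q * r) ≤ v := by
  rcases le_total r q with h | h
  · have : r ^ 2 - q * r ≤ 0 := by nlinarith
    exact (mul_nonpos_of_nonneg_of_nonpos hc0 this).trans hv0
  · have hrq : r ≤ 2 * q := by nlinarith
    have hcr : c * r ≤ r + q := by nlinarith
    nlinarith [mul_le_mul_of_nonneg_left hcr (sub_nonneg.2 h)]

theorem div_add_mul_le_add {c p q r u v w : ℝ} (hc0 : 0 < c) (hc : c ≤ 3 / 2)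
    (hp : 1 ≤ p) (hq : 1 ≤ q) (hr : 1 ≤ r) (hr2 : r ^ 2 ≤ 2)
    (hu : 0 ≤ u) (hv : 0 ≤ v) (hw : 0 ≤ w) (hwuv : w ≤ u + v)
    (hpu : r ^ 2 - p ^ 2 ≤ u) (hqv : r ^ 2 - q ^ 2 ≤ v) :
    w / (w + c * (p * q)) ≤ u / (u + c * (p * r)) + v / (v + c * (r * q)) := by
  have hA : 0 < c * (p * q) := by positivity
  have hP : 0 < c * (p * r) := by positivity
  have hQ : 0 < c * (r * q) := by positivity
  have hmono : w / (w + c * (p * q)) ≤ (u + v) / (u + v + c * (p * q)) := by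
    rw [div_le_div_iff₀ (by positivity) (by positivity)]
    nlinarith [mul_le_mul_of_nonneg_right hwuv hA.le]
  refine hmono.trans ?_
  have h₁ := mul_sq_sub_mul_le hc0.le hc hp (by linarith) hr2 hu hpu
  have h₂ := mul_sq_sub_mul_le hc0.le hc hq (by linarith) hr2 hv hqv
  have h₃ : 0 ≤ v * (u - c * (r ^ 2 - p * r)) + u * (v - c * (r ^ 2 - q * r)) :=
    add_nonneg (mul_nonneg hv (sub_nonneg.2 h₁)) (mul_nonneg hu (sub_nonneg.2 h₂))
  rw [div_add_div _ _ (by positivity) (by positivity),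
    div_le_div_iff₀ (by positivity) (by positivity)]
  have h₄ : 0 ≤ u * v * (u + v) := by positivity
  linear_combination h₄ + mul_nonneg hA.le h₃

theorem upsilon_is_metric {X : Type*} [MetricSpace X] (G : Set X)
    (hne : G.Nonempty) (hproper : G ≠ Set.univ) (hfr : (frontier G).Nonempty)
    (hdG : ∀ x ∈ G, Metric.infDist x (frontier G) ≤ 1)
    (c : ℝ) (hc0 : 0 < c) (hc2 : c ≤ Real.sqrt 2) :
    let dG : X → ℝ := fun x => Metric.infDist x (frontier G)
    let υ : X → X → ℝ := fun x y =>
      dist x y / (dist x y + c * Real.sqrt ((1 + dG x) * (1 + dG y)))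
    (∀ x ∈ G, ∀ y ∈ G, 0 ≤ υ x y ∧ (υ x y = 0 ↔ x = y)) ∧
    (∀ x ∈ G, ∀ y ∈ G, υ x y = υ y x) ∧
    (∀ x ∈ G, ∀ y ∈ G, ∀ z ∈ G, υ x y ≤ υ x z + υ z y) := by
  intro dG υ
  have hd (x : X) : 0 ≤ dG x := Metric.infDist_nonneg
  have hden (x y : X) : 0 < dist x y + c * Real.sqrt ((1 + dG x) * (1 + dG y)) := by
    have := hd x
    have := hd y
    positivity
  refine ⟨fun x _ y _ => ⟨div_nonneg dist_nonneg (hden x y).le, ?_⟩, fun x _ y _ => ?_,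
    fun x _ y _ z hz => ?_⟩
  · simp only [υ, div_eq_zero_iff, (hden x y).ne', or_false, dist_eq_zero]
  · simp only [υ, dist_comm x y, mul_comm (1 + dG x)]
  · have hsqrt (t : X) : 1 ≤ Real.sqrt (1 + dG t) := Real.one_le_sqrt.2 (by linarith [hd t])
    have hsq (t : X) : Real.sqrt (1 + dG t) ^ 2 = 1 + dG t := Real.sq_sqrt (by linarith [hd t])
    have hc : c ≤ 3 / 2 := hc2.trans (Real.sqrt_le_iff.2 (by norm_num))
    have hmul (s t : X) : Real.sqrt ((1 + dG s) * (1 + dG t)) =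
        Real.sqrt (1 + dG s) * Real.sqrt (1 + dG t) := Real.sqrt_mul (by linarith [hd s]) _
    have hzx : dG z ≤ dG x + dist z x := Metric.infDist_le_infDist_add_dist
    have hzy : dG z ≤ dG y + dist z y := Metric.infDist_le_infDist_add_dist
    have hz1 : dG z ≤ 1 := hdG z hz
    simp only [υ, hmul]
    refine div_add_mul_le_add hc0 hc (hsqrt x) (hsqrt y) (hsqrt z) ?_ dist_nonneg dist_nonneg
      dist_nonneg (dist_triangle x z y) ?_ ?_
    · rw [hsq]; linarith
    · rw [hsq, hsq, dist_comm]; linarith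
    · rw [hsq, hsq]; linarith
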